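/- Let H = (V,E) be a hypergraph of dimension d with n vertices, let X ⊆ V be nonempty, and let 1 ≤ j < k ≤ d − |X|. With p = 1/(2^{d+1}·Δ(H)) and each vertex marked independently with probability p, for every real λ > 1 we have Pr[S(X,j,k) > (1 + a_{k−j}·λ^{k−j}) · (Δ_{|X|+k}(H))^j] ≤ 2e²·e^{−λ}·n^{k−j−1}, where a_{k−j} = 8^{k−j}·((k−j)!)^{1/2}. -/

import Mathlib

open Finset

/-- The probability weight of a marking outcome `ω`, when each vertex is marked
independently with probability `p`. -/
noncomputable def markWeight {V : Type} [Fintype V] (p : ℝ) (ω : V → Bool) : ℝ :=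
  ∏ v, if ω v then p else 1 - p

open Classical in
/-- The probability of the event `A` under independent `Bernoulli(p)` marking of
the vertices. -/
noncomputable def markPr {V : Type} [Fintype V] (p : ℝ) (A : (V → Bool) → Prop) : ℝ :=
  ∑ ω : V → Bool, if A ω then markWeight p ω else 0

/-- The weighted count of fully marked edges, at a marking `ω`. -/
noncomputable def Sval {V : Type} (E : Finset (Finset V)) (w : Finset V → ℝ)
    (ω : V → Bool) : ℝ :=
  ∑ e ∈ E, w e * ∏ v ∈ e, (if ω v then (1 : ℝ) else 0)

/-- `N_j(x,H) = {y ⊆ V : x ∪ y ∈ E, x ∩ y = ∅, |y| = j}`. -/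
def Nset {V : Type} [Fintype V] [DecidableEq V] (E : Finset (Finset V))
    (x : Finset V) (j : ℕ) : Finset (Finset V) :=
  Finset.univ.filter (fun y => x ∪ y ∈ E ∧ x ∩ y = ∅ ∧ y.card = j)

/-- The normalized degree `d_j(x,H) = |N_j(x,H)|^(1/j)`. -/
noncomputable def dDeg {V : Type} [Fintype V] [DecidableEq V] (E : Finset (Finset V))
    (x : Finset V) (j : ℕ) : ℝ :=
  ((Nset E x j).card : ℝ) ^ (1 / (j : ℝ))

/-- `Δ_i(H) = max{d_{i−|x|}(x,H) : x ⊆ V, 0 < |x| < i}`. -/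
noncomputable def DeltaI {V : Type} [Fintype V] [DecidableEq V] (E : Finset (Finset V))
    (i : ℕ) : ℝ :=
  sSup {r : ℝ | ∃ x : Finset V, 0 < x.card ∧ x.card < i ∧ r = dDeg E x (i - x.card)}

/-- `Δ(H) = max{Δ_i(H) : 2 ≤ i ≤ d}`. -/
noncomputable def Delta {V : Type} [Fintype V] [DecidableEq V] (E : Finset (Finset V))
    (d : ℕ) : ℝ :=
  sSup {r : ℝ | ∃ i : ℕ, 2 ≤ i ∧ i ≤ d ∧ r = DeltaI E i}

open Classical in
/-- The expectation of `f` under independent `Bernoulli(p)` marking of the vertices. -/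
noncomputable def markExp {V : Type} [Fintype V] (p : ℝ) (f : (V → Bool) → ℝ) : ℝ :=
  ∑ ω : V → Bool, markWeight p ω * f ω

/-- The indicator that all vertices of `U` are marked. -/
def allMarked {V : Type} (U : Finset V) (ω : V → Bool) : ℝ :=
  ∏ v ∈ U, if ω v then (1 : ℝ) else 0

section Marking

variable {V : Type}

lemma allMarked_nonneg (U : Finset V) (ω : V → Bool) : 0 ≤ allMarked U ω :=
  Finset.prod_nonneg fun v _ => by split_ifs <;> norm_num

lemma allMarked_union [DecidableEq V] (U Y : Finset V) (ω : V → Bool) :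
    allMarked (U ∪ Y) ω = allMarked U ω * allMarked Y ω := by
  have h : ∀ W : Finset V, allMarked W ω = if ∀ v ∈ W, ω v = true then (1 : ℝ) else 0 := by
    intro W
    unfold allMarked
    rw [Finset.prod_ite_zero]
    simp
  simp only [h, Finset.mem_union, or_imp, forall_and]
  by_cases h1 : ∀ v ∈ U, ω v = true
  · rw [if_pos h1, one_mul]
    exact if_congr (and_iff_right h1) rfl rfl
  · rw [if_neg h1, zero_mul, if_neg fun h => h1 h.1]

lemma Sval_eq (F : Finset (Finset V)) (w : Finset V → ℝ) (ω : V → Bool) :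
    Sval F w ω = ∑ Y ∈ F, w Y * allMarked Y ω := rfl

lemma Sval_nonneg (F : Finset (Finset V)) {w : Finset V → ℝ} (hw : ∀ Y, 0 ≤ w Y)
    (ω : V → Bool) : 0 ≤ Sval F w ω :=
  Finset.sum_nonneg fun Y _ => mul_nonneg (hw Y) (allMarked_nonneg Y ω)

/-- If all the conditional weights `∑_{Y ⊇ A} w Y p^(m - |A|)` are at most `W`, then the
expected weight given that a set of at most `R * m` vertices is marked is at most
`(e * R)^m * W`. -/
lemma sum_mul_pow_card_sdiff_le [DecidableEq V] {p : ℝ} (hp0 : 0 ≤ p)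
    {F : Finset (Finset V)} {w : Finset V → ℝ} (hw : ∀ Y, 0 ≤ w Y) {m R : ℕ}
    (hF : ∀ Y ∈ F, Y.card = m) {W : ℝ} (hW0 : 0 ≤ W)
    (hW : ∀ A : Finset V, A.card ≤ m → ∑ Y ∈ F with A ⊆ Y, w Y * p ^ (m - A.card) ≤ W)
    (hR : 0 < R) (U : Finset V) (hU : U.card ≤ R * m) :
    ∑ Y ∈ F, w Y * p ^ (Y \ U).card ≤ (Real.exp 1 * R) ^ m * W := by
  have hR1 : (1 : ℝ) ≤ R := by exact_mod_cast hR
  have hRpos : (0 : ℝ) < R := by linarith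
  have hmaps : ∀ Y ∈ F, Y ∩ U ∈ U.powerset := fun Y _ =>
    Finset.mem_powerset.2 Finset.inter_subset_right
  rw [← Finset.sum_fiberwise_of_maps_to hmaps]
  calc ∑ A ∈ U.powerset, ∑ Y ∈ F with Y ∩ U = A, w Y * p ^ (Y \ U).card
      ≤ ∑ A ∈ U.powerset, ((1 / R : ℝ) ^ A.card * 1 ^ (U.card - A.card)) * (R ^ m * W) := by
        refine Finset.sum_le_sum fun A _ => ?_
        by_cases hA : A.card ≤ m
        · have h1 : ∑ Y ∈ F with Y ∩ U = A, w Y * p ^ (Y \ U).card ≤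
              ∑ Y ∈ F with A ⊆ Y, w Y * p ^ (m - A.card) := by
            calc ∑ Y ∈ F with Y ∩ U = A, w Y * p ^ (Y \ U).card
                = ∑ Y ∈ F with Y ∩ U = A, w Y * p ^ (m - A.card) := by
                  refine Finset.sum_congr rfl fun Y hY => ?_
                  obtain ⟨hY1, hY2⟩ := Finset.mem_filter.1 hY
                  rw [Finset.card_sdiff, Finset.inter_comm, hY2, hF Y hY1]
              _ ≤ _ := by
                  refine Finset.sum_le_sum_of_subset_of_nonneg ?_ fun Y _ _ =>
                    mul_nonneg (hw Y) (pow_nonneg hp0 _)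
                  intro Y hY
                  obtain ⟨hY1, hY2⟩ := Finset.mem_filter.1 hY
                  exact Finset.mem_filter.2 ⟨hY1, hY2 ▸ Finset.inter_subset_left⟩
          refine (h1.trans (hW A hA)).trans ?_
          have h2 : (1 / R : ℝ) ^ A.card * R ^ m = R ^ (m - A.card) := by
            rw [← Nat.sub_add_cancel hA, pow_add, Nat.add_sub_cancel, one_div, inv_pow]
            field_simp
          rw [one_pow, mul_one, ← mul_assoc, h2]
          exact le_mul_of_one_le_left hW0 (one_le_pow₀ hR1)
        · rw [Finset.filter_eq_empty_iff.2, Finset.sum_empty]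
          · positivity
          · intro Y hY hYA
            have h := Finset.card_le_card (Finset.inter_subset_left : Y ∩ U ⊆ Y)
            rw [hYA, hF Y hY] at h
            exact hA h
    _ = (1 / R + 1) ^ U.card * (R ^ m * W) := by
        rw [← Finset.sum_mul, Finset.sum_pow_mul_eq_add_pow]
    _ ≤ (Real.exp 1) ^ m * (R ^ m * W) := by
        refine mul_le_mul_of_nonneg_right ?_ (by positivity)
        calc (1 / R + 1 : ℝ) ^ U.card ≤ (1 / R + 1 : ℝ) ^ (R * m) :=
              pow_le_pow_right₀ (by have : (0 : ℝ) ≤ 1 / R := by positivity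
                                    linarith) hU
          _ ≤ (Real.exp (1 / R)) ^ (R * m) :=
              pow_le_pow_left₀ (by positivity) (Real.add_one_le_exp _) _
          _ = (Real.exp 1) ^ m := by
              rw [pow_mul, ← Real.exp_nat_mul, mul_one_div_cancel hRpos.ne']
    _ = _ := by rw [mul_pow]; ring

variable [Fintype V]

lemma markWeight_nonneg {p : ℝ} (hp0 : 0 ≤ p) (hp1 : p ≤ 1) (ω : V → Bool) :
    0 ≤ markWeight p ω :=
  Finset.prod_nonneg fun v _ => by split_ifs <;> linarith

lemma markExp_allMarked (p : ℝ) (U : Finset V) :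
    markExp p (allMarked U) = p ^ U.card := by
  classical
  have h : ∀ ω : V → Bool, markWeight p ω * allMarked U ω =
      ∏ v, (if ω v then p else 1 - p) * (if v ∈ U then (if ω v then (1 : ℝ) else 0) else 1) := by
    intro ω
    rw [Finset.prod_mul_distrib]
    congr 1
    simp [allMarked, Finset.prod_ite_mem]
  unfold markExp
  simp_rw [h]
  rw [← Fintype.piFinset_univ, ← Finset.prod_univ_sum (fun _ => Finset.univ)
    (fun v (b : Bool) => (if b then p else 1 - p) *
      (if v ∈ U then (if b then (1 : ℝ) else 0) else 1))]
  have h2 : ∀ v, (∑ b : Bool, (if b then p else 1 - p) *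
      (if v ∈ U then (if b then (1 : ℝ) else 0) else 1)) = if v ∈ U then p else 1 := by
    intro v
    by_cases hv : v ∈ U <;> simp [hv]
  simp_rw [h2]
  simp [Finset.prod_ite_mem]

/-- A moment bound for the weighted number of marked edges. -/
lemma markExp_allMarked_mul_Sval_pow_le [DecidableEq V] {p : ℝ} (hp0 : 0 ≤ p)
    {F : Finset (Finset V)} {w : Finset V → ℝ} (hw : ∀ Y, 0 ≤ w Y) {m N : ℕ}
    (hF : ∀ Y ∈ F, Y.card = m) {K : ℝ} (hK0 : 0 ≤ K)
    (hK : ∀ U : Finset V, U.card + m ≤ N → ∑ Y ∈ F, w Y * p ^ (Y \ U).card ≤ K)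
    (r : ℕ) (U : Finset V) (hU : U.card + r * m ≤ N) :
    markExp p (fun ω => allMarked U ω * Sval F w ω ^ r) ≤ p ^ U.card * K ^ r := by
  induction r generalizing U with
  | zero => simpa using (markExp_allMarked p U).le
  | succ r ih =>
    have hexp : markExp p (fun ω => allMarked U ω * Sval F w ω ^ (r + 1)) =
        ∑ Y ∈ F, w Y * markExp p (fun ω => allMarked (U ∪ Y) ω * Sval F w ω ^ r) := by
      unfold markExp
      simp_rw [Finset.mul_sum]
      rw [Finset.sum_comm]
      refine Finset.sum_congr rfl fun ω _ => ?_
      rw [pow_succ, Sval_eq F w ω]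
      simp_rw [← mul_assoc]
      rw [Finset.mul_sum]
      refine Finset.sum_congr rfl fun Y _ => ?_
      rw [allMarked_union]
      ring
    rw [add_mul, one_mul] at hU
    rw [hexp]
    calc ∑ Y ∈ F, w Y * markExp p (fun ω => allMarked (U ∪ Y) ω * Sval F w ω ^ r)
        ≤ ∑ Y ∈ F, w Y * (p ^ (U ∪ Y).card * K ^ r) := by
          refine Finset.sum_le_sum fun Y hY => mul_le_mul_of_nonneg_left (ih _ ?_) (hw Y)
          have h1 := Finset.card_union_le U Y
          have h2 := hF Y hY
          omega
      _ = p ^ U.card * K ^ r * ∑ Y ∈ F, w Y * p ^ (Y \ U).card := by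
          rw [Finset.mul_sum]
          refine Finset.sum_congr rfl fun Y _ => ?_
          have h : (U ∪ Y).card = U.card + (Y \ U).card := by
            rw [← Finset.union_sdiff_self_eq_union,
              Finset.card_union_of_disjoint Finset.disjoint_sdiff]
          rw [h, pow_add]
          ring
      _ ≤ p ^ U.card * K ^ r * K := by
          refine mul_le_mul_of_nonneg_left (hK U ?_) (by positivity)
          have := Nat.zero_le (r * m)
          omega
      _ = p ^ U.card * K ^ (r + 1) := by ring

/-- Markov's inequality for the `r`-th moment. -/
lemma markPr_mul_pow_le {p : ℝ} (hp0 : 0 ≤ p) (hp1 : p ≤ 1)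
    {f : (V → Bool) → ℝ} (hf : ∀ ω, 0 ≤ f ω) {A : (V → Bool) → Prop} {t : ℝ} (ht : 0 ≤ t)
    (hA : ∀ ω, A ω → t ≤ f ω) (r : ℕ) :
    markPr p A * t ^ r ≤ markExp p (fun ω => f ω ^ r) := by
  unfold markPr markExp
  rw [Finset.sum_mul]
  refine Finset.sum_le_sum fun ω _ => ?_
  have hm := markWeight_nonneg hp0 hp1 ω
  split_ifs with h
  · exact mul_le_mul_of_nonneg_left (pow_le_pow_left₀ ht (hA ω h) r) hm
  · have := pow_nonneg (hf ω) r
    rw [zero_mul]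
    positivity

end Marking

/-- An exponential tail bound for the weighted number of marked edges of an `m`-uniform
hypergraph all of whose conditional weights are at most `W`. -/
lemma markPr_Sval_le {V : Type} [Fintype V] [DecidableEq V] {p : ℝ} (hp0 : 0 ≤ p) (hp1 : p ≤ 1)
    {F : Finset (Finset V)} {w : Finset V → ℝ} (hw : ∀ Y, 0 ≤ w Y) {m : ℕ} (hm : 0 < m)
    (hF : ∀ Y ∈ F, Y.card = m) {W : ℝ} (hW0 : 0 < W)
    (hW : ∀ A : Finset V, A.card ≤ m → ∑ Y ∈ F with A ⊆ Y, w Y * p ^ (m - A.card) ≤ W)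
    {lam : ℝ} (hlam : 0 < lam) {A : (V → Bool) → Prop}
    (hA : ∀ ω, A ω → (8 * lam) ^ m * W ≤ Sval F w ω) :
    markPr p A ≤ Real.exp (m - lam) := by
  have hm1 : (1 : ℝ) ≤ m := by exact_mod_cast hm
  have hm0 : (0 : ℝ) < m := by linarith
  set R := ⌊lam / m⌋₊ with hR
  have hRlam : (R : ℝ) ≤ lam :=
    (Nat.floor_le (by positivity)).trans (div_le_self hlam.le hm1)
  have hRm : lam - m ≤ m * R := by
    have h := (Nat.lt_floor_add_one (lam / m)).le
    rw [div_le_iff₀ hm0, ← hR] at h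
    linarith
  have hmom := markExp_allMarked_mul_Sval_pow_le hp0 hw hF
    (K := (Real.exp 1 * R) ^ m * W) (N := R * m) (by positivity)
    (fun U hU => by
      rcases Nat.eq_zero_or_pos R with h0 | h0
      · rw [h0] at hU; omega
      · exact sum_mul_pow_card_sdiff_le hp0 hw hF hW0.le hW h0 U (by omega)) R ∅ (by simp)
  have hmarkov := markPr_mul_pow_le hp0 hp1 (Sval_nonneg F hw)
    (t := (8 * lam) ^ m * W) (by positivity) hA R
  simp only [allMarked, Finset.prod_empty, one_mul, Finset.card_empty, pow_zero] at hmom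
  have hpos : 0 < ((8 * lam) ^ m * W) ^ R := by positivity
  have hexp : Real.exp 1 * Real.exp 1 ≤ 8 := by
    nlinarith [Real.exp_one_lt_d9, Real.exp_pos 1]
  have hbase : Real.exp 1 * R ≤ Real.exp (-1) * (8 * lam) := by
    have h1 : Real.exp (-1) * Real.exp 1 = 1 := by rw [← Real.exp_add]; simp
    calc Real.exp 1 * R ≤ Real.exp 1 * lam := by gcongr
      _ = Real.exp (-1) * (Real.exp 1 * Real.exp 1 * lam) := by
          linear_combination (-(Real.exp 1 * lam)) * h1
      _ ≤ Real.exp (-1) * (8 * lam) := by gcongr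
  have hfin : markPr p A * ((8 * lam) ^ m * W) ^ R ≤
      Real.exp (-(m * R)) * ((8 * lam) ^ m * W) ^ R := by
    calc _ ≤ ((Real.exp 1 * R) ^ m * W) ^ R := hmarkov.trans hmom
      _ ≤ ((Real.exp (-1) * (8 * lam)) ^ m * W) ^ R := by gcongr
      _ = (Real.exp (-1) ^ m) ^ R * ((8 * lam) ^ m * W) ^ R := by
          rw [mul_pow (Real.exp (-1)), mul_assoc, mul_pow]
      _ = _ := by
          rw [← pow_mul, ← Real.exp_nat_mul]
          push_cast
          ring_nf
  exact (le_of_mul_le_mul_right hfin hpos).trans (Real.exp_le_exp.2 (by linarith))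

section Degrees

variable {V : Type} [Fintype V] [DecidableEq V]

lemma dDeg_nonneg (E : Finset (Finset V)) (x : Finset V) (j : ℕ) : 0 ≤ dDeg E x j := by
  unfold dDeg; positivity

lemma DeltaI_nonneg (E : Finset (Finset V)) (i : ℕ) : 0 ≤ DeltaI E i := by
  refine Real.sSup_nonneg ?_
  rintro r ⟨x, -, -, rfl⟩
  exact dDeg_nonneg E x _

lemma dDeg_le_DeltaI (E : Finset (Finset V)) {i : ℕ} {x : Finset V} (hx : 0 < x.card)
    (hxi : x.card < i) : dDeg E x (i - x.card) ≤ DeltaI E i := by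
  refine le_csSup (Set.Finite.bddAbove ?_) ⟨x, hx, hxi, rfl⟩
  refine (Set.finite_range fun x : Finset V => dDeg E x (i - x.card)).subset ?_
  rintro r ⟨x, -, -, rfl⟩
  exact ⟨x, rfl⟩

lemma DeltaI_le_Delta (E : Finset (Finset V)) {i d : ℕ} (hi : 2 ≤ i) (hid : i ≤ d) :
    DeltaI E i ≤ Delta E d := by
  refine le_csSup (Set.Finite.bddAbove ?_) ⟨i, hi, hid, rfl⟩
  refine ((Set.finite_Iic d).image (DeltaI E)).subset ?_
  rintro r ⟨i, -, hi, rfl⟩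
  exact ⟨i, hi, rfl⟩

lemma one_le_DeltaI_of_pos {E : Finset (Finset V)} {i : ℕ} (h : 0 < DeltaI E i) :
    1 ≤ DeltaI E i := by
  by_contra hlt
  refine h.not_ge (Real.sSup_nonpos ?_)
  rintro r ⟨x, hx, hxi, rfl⟩
  have hle := dDeg_le_DeltaI E hx hxi
  have hi : ((i - x.card : ℕ) : ℝ) ≠ 0 := by
    exact_mod_cast (Nat.sub_pos_of_lt hxi).ne'
  rcases Nat.eq_zero_or_pos (Nset E x (i - x.card)).card with h0 | h0
  · unfold dDeg
    rw [h0, Nat.cast_zero, Real.zero_rpow (one_div_ne_zero hi)]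
  · have : 1 ≤ dDeg E x (i - x.card) :=
      Real.one_le_rpow (by exact_mod_cast h0) (by positivity)
    exact absurd (this.trans hle) hlt

lemma card_Nset_le_DeltaI_pow (E : Finset (Finset V)) {i l : ℕ} {x : Finset V}
    (hx : 0 < x.card) (hl : 0 < l) (hi : x.card + l = i) :
    ((Nset E x l).card : ℝ) ≤ DeltaI E i ^ l := by
  have h := dDeg_le_DeltaI E hx (show x.card < i by omega)
  rw [show i - x.card = l by omega] at h
  have h2 : dDeg E x l ^ l = ((Nset E x l).card : ℝ) := by
    unfold dDeg
    rw [one_div, Real.rpow_inv_natCast_pow (by positivity) hl.ne']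
  rw [← h2]
  exact pow_le_pow_left₀ (dDeg_nonneg E x l) h l

/-- Splitting the members of `N_{m - |A| + j}(X ∪ A)` into two parts. -/
lemma sum_card_Nset_le (E : Finset (Finset V)) {X A : Finset V} {F : Finset (Finset V)}
    {m j : ℕ} (hF : ∀ Y ∈ F, Y.card = m ∧ Disjoint X Y) :
    ∑ Y ∈ F with A ⊆ Y, (Nset E (X ∪ Y) j).card ≤
      (Nset E (X ∪ A) (m - A.card + j)).card * 2 ^ (m - A.card + j) := by
  rw [← Finset.card_sigma]
  have hcard : ((Nset E (X ∪ A) (m - A.card + j)).sigma fun u => u.powerset).card =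
      (Nset E (X ∪ A) (m - A.card + j)).card * 2 ^ (m - A.card + j) := by
    rw [Finset.card_sigma]
    refine Finset.sum_const_nat fun u hu => ?_
    rw [Finset.card_powerset, (Finset.mem_filter.1 hu).2.2.2]
  rw [← hcard]
  refine Finset.card_le_card_of_injOn
    (fun q => (⟨q.1 \ A ∪ q.2, q.2⟩ : (_ : Finset V) × Finset V)) ?_ ?_
  · rintro ⟨Y, z⟩ hq
    simp only [Finset.coe_sigma, Set.mem_sigma_iff, Finset.mem_coe, Finset.mem_filter, Nset,
      Finset.mem_univ, true_and, Finset.mem_powerset] at hq ⊢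
    obtain ⟨⟨hY, hAY⟩, hE, hdisj, hz⟩ := hq
    obtain ⟨hYc, hXY⟩ := hF Y hY
    rw [← Finset.disjoint_iff_inter_eq_empty, Finset.disjoint_union_left] at hdisj
    refine ⟨⟨?_, ?_, ?_⟩, Finset.subset_union_right⟩
    · have : X ∪ A ∪ (Y \ A ∪ z) = X ∪ Y ∪ z := by
        rw [← Finset.union_assoc, Finset.union_assoc X, Finset.union_sdiff_of_subset hAY]
      rwa [this]
    · rw [← Finset.disjoint_iff_inter_eq_empty, Finset.disjoint_union_left,
        Finset.disjoint_union_right, Finset.disjoint_union_right]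
      exact ⟨⟨hXY.mono_right Finset.sdiff_subset, hdisj.1⟩,
        Finset.disjoint_sdiff, hdisj.2.mono_left hAY⟩
    · rw [Finset.card_union_of_disjoint (hdisj.2.mono_left Finset.sdiff_subset),
        Finset.card_sdiff_of_subset hAY, hYc, hz]
  · rintro ⟨Y, z⟩ hq ⟨Y', z'⟩ hq' heq
    simp only [Finset.coe_sigma, Set.mem_sigma_iff, Finset.mem_coe, Finset.mem_filter, Nset,
      Finset.mem_univ, true_and] at hq hq'
    simp only [Sigma.mk.injEq, heq_eq_eq] at heq ⊢
    obtain ⟨h1, rfl⟩ := heq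
    obtain ⟨⟨hY, hAY⟩, hE, hdisj, hz⟩ := hq
    obtain ⟨⟨hY', hAY'⟩, hE', hdisj', hz'⟩ := hq'
    rw [← Finset.disjoint_iff_inter_eq_empty, Finset.disjoint_union_left] at hdisj hdisj'
    refine ⟨?_, rfl⟩
    have h2 : Y \ A = Y' \ A := by
      rw [← Finset.union_sdiff_cancel_right (hdisj.2.mono_left Finset.sdiff_subset), h1,
        Finset.union_sdiff_cancel_right (hdisj'.2.mono_left Finset.sdiff_subset)]
    rw [← Finset.sdiff_union_of_subset hAY, h2, Finset.sdiff_union_of_subset hAY']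

/-- The conditional expected weights of `S(X, j, k)` are at most `Δ_{|X|+k}^j`. -/
lemma sum_card_Nset_mul_pow_le (E : Finset (Finset V)) {d : ℕ} {X A : Finset V}
    (hX : X.Nonempty) {F : Finset (Finset V)} {m j : ℕ} (hj : 0 < j)
    (hd : X.card + (m + j) ≤ d) (hF : ∀ Y ∈ F, Y.card = m ∧ Disjoint X Y)
    (hA : A.card ≤ m) {p : ℝ} (hp0 : 0 ≤ p)
    (hp : p * DeltaI E (X.card + (m + j)) ≤ (1 / 2) ^ (d + 1)) :
    ∑ Y ∈ F with A ⊆ Y, ((Nset E (X ∪ Y) j).card : ℝ) * p ^ (m - A.card) ≤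
      DeltaI E (X.card + (m + j)) ^ j := by
  set D := DeltaI E (X.card + (m + j)) with hD
  have hD0 : 0 ≤ D := DeltaI_nonneg E _
  rcases (F.filter (A ⊆ ·)).eq_empty_or_nonempty with h0 | ⟨Y₀, hY₀⟩
  · rw [h0, Finset.sum_empty]; positivity
  obtain ⟨hY₀F, hAY₀⟩ := Finset.mem_filter.1 hY₀
  have hXA : (X ∪ A).card = X.card + A.card :=
    Finset.card_union_of_disjoint ((hF Y₀ hY₀F).2.mono_right hAY₀)
  have hXpos := hX.card_pos
  have hN : ((Nset E (X ∪ A) (m - A.card + j)).card : ℝ) ≤ D ^ (m - A.card + j) :=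
    card_Nset_le_DeltaI_pow E (by omega) (by omega) (by omega)
  rw [← Finset.sum_mul]
  rcases hA.eq_or_lt with hAm | hAm
  · have hsub : F.filter (A ⊆ ·) ⊆ {A} := fun Y hY => by
      obtain ⟨hYF, hAY⟩ := Finset.mem_filter.1 hY
      rw [Finset.mem_singleton]
      exact (Finset.eq_of_subset_of_card_le hAY (by rw [(hF Y hYF).1, hAm])).symm
    rw [hAm, Nat.sub_self, zero_add] at hN
    rw [hAm, Nat.sub_self, pow_zero, mul_one]
    refine (Finset.sum_le_sum_of_subset_of_nonneg hsub fun _ _ _ => by positivity).trans ?_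
    rwa [Finset.sum_singleton]
  · have hs : (∑ Y ∈ F with A ⊆ Y, ((Nset E (X ∪ Y) j).card : ℝ)) ≤
        (Nset E (X ∪ A) (m - A.card + j)).card * 2 ^ (m - A.card + j) := by
      exact_mod_cast sum_card_Nset_le E hF
    set l := m - A.card with hl
    have hpow : (2 : ℝ) ^ (l + j) * ((1 / 2) ^ (d + 1)) ^ l ≤ 1 := by
      have h1 : l + j ≤ (d + 1) * l := by
        have : (d + 1) * 1 ≤ (d + 1) * l := Nat.mul_le_mul_left _ (by omega)
        omega
      rw [← pow_mul]
      calc (2 : ℝ) ^ (l + j) * (1 / 2) ^ ((d + 1) * l)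
          ≤ 2 ^ ((d + 1) * l) * (1 / 2) ^ ((d + 1) * l) := by
            gcongr
            norm_num
        _ = 1 := by rw [← mul_pow]; norm_num
    calc (∑ Y ∈ F with A ⊆ Y, ((Nset E (X ∪ Y) j).card : ℝ)) * p ^ l
        ≤ (D ^ (l + j) * 2 ^ (l + j)) * p ^ l := by
          gcongr
          exact hs.trans (by gcongr)
      _ = D ^ j * (2 ^ (l + j) * (p * D) ^ l) := by rw [mul_pow, pow_add D]; ring
      _ ≤ D ^ j * (2 ^ (l + j) * ((1 / 2) ^ (d + 1)) ^ l) := by gcongr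
      _ ≤ D ^ j * 1 := by gcongr
      _ = D ^ j := mul_one _

end Degrees

/-- improved Corollary 2, via Kim–Vu: for a hypergraph `H` of dimension `d`
with `n` vertices, nonempty `X ⊆ V`, and `1 ≤ j < k ≤ d − |X|`, with
`p = 1/(2^(d+1)·Δ(H))`, for every `λ > 1`,
`Pr[S(X,j,k) > (1 + a_{k−j}·λ^(k−j))·(Δ_{|X|+k}(H))^j] ≤ 2e²·e^(−λ)·n^(k−j−1)`,
where `a_{k−j} = 8^(k−j)·((k−j)!)^(1/2)` and `S(X,j,k)` is the weighted number of fully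
marked edges of the hypergraph with edge set
`X_{j,k} = {Y : |Y| = k−j, Y ⊆ Z for some Z ∈ N_k(X,H)}` and weights
`w'(Y) = |N_j(X ∪ Y,H)|`. -/
theorem stmt3 {V : Type} [Fintype V] [DecidableEq V]
    (E : Finset (Finset V)) (d : ℕ)
    (hEne : ∀ e ∈ E, e.Nonempty)
    (hdim : (∀ e ∈ E, e.card ≤ d) ∧ ∃ e ∈ E, e.card = d)
    (X : Finset V) (hX : X.Nonempty)
    (j k : ℕ) (hj : 1 ≤ j) (hjk : j < k) (hk : X.card + k ≤ d)
    (lam : ℝ) (hlam : 1 < lam) :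
    markPr (1 / (2 ^ (d + 1) * Delta E d)) (fun ω =>
        Sval
            (Finset.univ.filter (fun Y : Finset V =>
              Y.card = k - j ∧ ∃ Z ∈ Nset E X k, Y ⊆ Z))
            (fun Y => ((Nset E (X ∪ Y) j).card : ℝ)) ω
          > (1 + 8 ^ (k - j) * Real.sqrt (Nat.factorial (k - j)) * lam ^ (k - j)) *
              (DeltaI E (X.card + k)) ^ j)
      ≤ 2 * Real.exp 2 * Real.exp (-lam) * (Fintype.card V : ℝ) ^ (k - j - 1) := by
  obtain ⟨m, rfl⟩ : ∃ m, k = m + j := ⟨k - j, by omega⟩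
  rw [Nat.add_sub_cancel]
  have hm : 0 < m := by omega
  have hXpos := hX.card_pos
  set D := DeltaI E (X.card + (m + j)) with hD
  set F : Finset (Finset V) := Finset.univ.filter (fun Y : Finset V =>
    Y.card = m ∧ ∃ Z ∈ Nset E X (m + j), Y ⊆ Z)
  have hF : ∀ Y ∈ F, Y.card = m ∧ Disjoint X Y := by
    intro Y hY
    obtain ⟨-, hYm, Z, hZ, hYZ⟩ := Finset.mem_filter.1 hY
    have hXZ := (Finset.mem_filter.1 hZ).2.2.1
    exact ⟨hYm, (Finset.disjoint_iff_inter_eq_empty.2 hXZ).mono_right hYZ⟩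
  have hD0 : 0 ≤ D := DeltaI_nonneg E _
  rcases hD0.eq_or_lt with hDz | hDpos
  · have hS : ∀ ω, Sval F (fun Y => ((Nset E (X ∪ Y) j).card : ℝ)) ω = 0 := by
      intro ω
      refine Finset.sum_eq_zero fun Y hY => ?_
      obtain ⟨hYm, hXY⟩ := hF Y hY
      have hc := Finset.card_union_of_disjoint hXY
      have h := card_Nset_le_DeltaI_pow E (x := X ∪ Y) (l := j) (i := X.card + (m + j))
        (by omega) (by omega) (by omega)
      rw [← hD, ← hDz, zero_pow (by omega)] at h
      exact mul_eq_zero_of_left (le_antisymm h (by positivity)) _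
    have hzero : ∀ c : ℝ, ¬ ((0 : ℝ) > c * D ^ j) := by
      intro c
      rw [← hDz, zero_pow (by omega), mul_zero]
      exact lt_irrefl 0
    simp only [hS, markPr, hzero, if_false, Finset.sum_const_zero]
    positivity
  have hD1 : 1 ≤ D := one_le_DeltaI_of_pos hDpos
  have hDD : D ≤ Delta E d := DeltaI_le_Delta E (by omega) hk
  have hDel : 0 < Delta E d := by linarith
  have hp0 : 0 ≤ 1 / (2 ^ (d + 1) * Delta E d) := by positivity
  have hp1 : 1 / (2 ^ (d + 1) * Delta E d) ≤ 1 := by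
    rw [div_le_one (by positivity)]
    exact one_le_mul_of_one_le_of_one_le (one_le_pow₀ (by norm_num)) (by linarith)
  have hp : 1 / (2 ^ (d + 1) * Delta E d) * D ≤ (1 / 2) ^ (d + 1) := by
    rw [div_mul_eq_mul_div, one_mul, div_le_iff₀ (by positivity), ← mul_assoc, ← mul_pow]
    norm_num
    exact hDD
  have hmain := markPr_Sval_le (m := m) (W := D ^ j) (lam := lam) hp0 hp1
    (F := F) (w := fun Y => ((Nset E (X ∪ Y) j).card : ℝ)) (fun _ => by positivity) hm
    (fun Y hY => (hF Y hY).1) (by positivity)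
    (fun A hA => sum_card_Nset_mul_pow_le E hX (by omega) hk hF hA hp0 hp) (by linarith)
    (A := fun ω => Sval F (fun Y => ((Nset E (X ∪ Y) j).card : ℝ)) ω >
      (1 + 8 ^ m * Real.sqrt (Nat.factorial m) * lam ^ m) * D ^ j)
    (fun ω hω => by
      refine le_trans ?_ (le_of_lt hω)
      have hsq : 1 ≤ Real.sqrt (Nat.factorial m) := by
        rw [Real.one_le_sqrt]
        exact_mod_cast Nat.one_le_iff_ne_zero.2 (Nat.factorial_ne_zero m)
      gcongr
      rw [mul_pow]
      have h8 : (8 : ℝ) ^ m * 1 * lam ^ m ≤ 8 ^ m * Real.sqrt (Nat.factorial m) * lam ^ m := by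
        gcongr
      linarith)
  refine hmain.trans ?_
  obtain ⟨e, -, hecard⟩ := hdim.2
  have hn : 3 ≤ Fintype.card V ∨ m = 1 := by
    have := Finset.card_le_univ e
    omega
  have hpow : Real.exp 1 ^ (m - 1) ≤ (Fintype.card V : ℝ) ^ (m - 1) := by
    rcases hn with hn | hn
    · have hn' : (3 : ℝ) ≤ Fintype.card V := by exact_mod_cast hn
      exact pow_le_pow_left₀ (Real.exp_pos 1).le
        (by linarith [Real.exp_one_lt_d9]) _
    · rw [hn]; simp
  have hexp : Real.exp (m - lam) = Real.exp 1 * Real.exp (-lam) * Real.exp 1 ^ (m - 1) := by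
    rw [← Real.exp_nat_mul, ← Real.exp_add, ← Real.exp_add, Nat.cast_sub hm]
    congr 1
    push_cast
    ring
  rw [hexp]
  have h12 : Real.exp 1 ≤ 2 * Real.exp 2 := by
    have := Real.exp_le_exp.2 (show (1 : ℝ) ≤ 2 by norm_num)
    linarith [Real.exp_pos 2]
  gcongr
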